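/- For any finitely many elements f₁, …, f_k of Thompson's group F, all different from the identity, there exists g ∈ F such that g⁻¹ ∘ f_j ∘ g ∉ H₂ for all j = 1, …, k. In particular, the intersection of all conjugates of H₂ in F is the trivial subgroup, so the action of F on the coset space F/H₂ is faithful. -/

import Mathlib

open Set MeasureTheory Filter Topology

/-- The binary Cantor space. -/
abbrev CantorC : Type := ℕ → Bool

/-- Finite binary words. -/
abbrev BWord : Type := List Bool

/-- Prepend a finite word to an infinite binary sequence. -/
def wordApp (w : BWord) (x : CantorC) : CantorC := fun n =>
  if h : n < w.length then w.get ⟨n, h⟩ else x (n - w.length)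

/-- The cylinder of sequences beginning with the word `w`. -/
def cyl (w : BWord) : Set CantorC := Set.range (wordApp w)

/-- `J` is a code: both the α-cylinders and the β-cylinders form a partition of the
Cantor space (every point lies in the cylinder of exactly one pair). -/
def IsCode (J : Finset (BWord × BWord)) : Prop :=
  (∀ x : CantorC, ∃! p : BWord × BWord, p ∈ J ∧ x ∈ cyl p.1) ∧
  (∀ x : CantorC, ∃! p : BWord × BWord, p ∈ J ∧ x ∈ cyl p.2)

/-- `J` is order preserving: α ≺ α' lexicographically iff β ≺ β' lexicographically. -/
def OrdPres (J : Finset (BWord × BWord)) : Prop :=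
  ∀ p ∈ J, ∀ q ∈ J, (List.Lex (· < ·) p.1 q.1 ↔ List.Lex (· < ·) p.2 q.2)

/-- The bijection `g` is induced by the code `J` : it maps `β·x` to `α·x`. -/
def InducedBy (J : Finset (BWord × BWord)) (g : Equiv.Perm CantorC) : Prop :=
  ∀ p ∈ J, ∀ x : CantorC, g (wordApp p.2 x) = wordApp p.1 x

/-- `J` is an order-preserving code inducing the bijection `g`. -/
def IsCodeFor (J : Finset (BWord × BWord)) (g : Equiv.Perm CantorC) : Prop :=
  IsCode J ∧ OrdPres J ∧ InducedBy J g

/-- Membership in (the realization on the Cantor space of) Thompson's group `F`. -/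
def InF (g : Equiv.Perm CantorC) : Prop := ∃ J, IsCodeFor J g

/-- The pair `(α, β)` has `|α| ≡ |β| (mod 2)`. -/
def EvenPair (p : BWord × BWord) : Prop := p.1.length % 2 = p.2.length % 2

/-- Membership in the subgroup `H₂` : some order-preserving code for `g` has all
pairs of even length difference. -/
def InH2 (g : Equiv.Perm CantorC) : Prop :=
  ∃ J, IsCodeFor J g ∧ ∀ p ∈ J, EvenPair p

/-- The union of the α-cylinders over pairs of even length difference. -/
def pSet (J : Finset (BWord × BWord)) : Set CantorC :=
  {x | ∃ p ∈ J, EvenPair p ∧ x ∈ cyl p.1}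

/-- The union of the β-cylinders over pairs of even length difference. -/
def eSet (J : Finset (BWord × BWord)) : Set CantorC :=
  {x | ∃ p ∈ J, EvenPair p ∧ x ∈ cyl p.2}

/-- `p_f` : for `f ∈ F` this equals `pSet J` for any (equivalently, every)
order-preserving code `J` for `f`. -/
def pF (g : Equiv.Perm CantorC) : Set CantorC :=
  ⋃ J ∈ {J : Finset (BWord × BWord) | IsCodeFor J g}, pSet J

/-- `E_f` : for `f ∈ F` this equals `eSet J` for any (equivalently, every)
order-preserving code `J` for `f`. -/
def EF (g : Equiv.Perm CantorC) : Set CantorC :=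
  ⋃ J ∈ {J : Finset (BWord × BWord) | IsCodeFor J g}, eSet J

/-- `Ω₂ = {p_f : f ∈ F}`. -/
def Omega2 : Set (Set CantorC) := {p | ∃ g, InF g ∧ pF g = p}

/-- The action `f · p = f(p ∩ E_f) ∪ f((C ∖ p) ∩ (C ∖ E_f))`. -/
def actF (g : Equiv.Perm CantorC) (p : Set CantorC) : Set CantorC :=
  g '' (p ∩ EF g) ∪ g '' (pᶜ ∩ (EF g)ᶜ)

open Classical in
/-- `T(p)` as a Boolean-valued characteristic function: `T(p) w = true` iff the
cylinder of `w` meets `p`. -/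
noncomputable def Tb (p : Set CantorC) : BWord → Bool :=
  fun w => if (cyl w ∩ p).Nonempty then true else false

/-- The embedding `p ↦ (T(p), T(C ∖ p))`. -/
noncomputable def embedT (p : Set CantorC) : (BWord → Bool) × (BWord → Bool) :=
  (Tb p, Tb pᶜ)

/-- `Ω̄₂` : the closure of the image of `Ω₂` under the embedding. -/
noncomputable def OmegaBar : Set ((BWord → Bool) × (BWord → Bool)) :=
  closure (embedT '' Omega2)

theorem wordApp_cons_zero (b : Bool) (w : BWord) (x : CantorC) : wordApp (b :: w) x 0 = b := by
  simp [wordApp]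

theorem wordApp_cons_succ (b : Bool) (w : BWord) (x : CantorC) (n : ℕ) :
    wordApp (b :: w) x (n + 1) = wordApp w x n := by
  simp [wordApp]

theorem wordApp_nil (x : CantorC) : wordApp [] x = x := by
  funext n
  simp [wordApp]

theorem wordApp_cons_inj (b c : Bool) (u w : BWord) (x y : CantorC) :
    wordApp (b :: u) x = wordApp (c :: w) y ↔ b = c ∧ wordApp u x = wordApp w y := by
  constructor
  · intro h
    refine ⟨?_, ?_⟩
    · simpa only [wordApp_cons_zero] using congrFun h 0
    · funext n
      simpa only [wordApp_cons_succ] using congrFun h (n + 1)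
  · rintro ⟨rfl, h⟩
    funext n
    cases n with
    | zero => simp only [wordApp_cons_zero]
    | succ n => simp only [wordApp_cons_succ, h]

theorem wordApp_append (u w : BWord) (x : CantorC) :
    wordApp (u ++ w) x = wordApp u (wordApp w x) := by
  induction u with
  | nil => simp [wordApp_nil]
  | cons b u ih => exact (wordApp_cons_inj _ _ _ _ _ _).2 ⟨rfl, ih⟩

theorem wordApp_injective (w : BWord) : Function.Injective (wordApp w) := by
  induction w with
  | nil => intro x y h; simpa only [wordApp_nil] using h
  | cons b w ih => exact fun x y h => ih ((wordApp_cons_inj _ _ _ _ _ _).1 h).2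

theorem wordApp_mem_cyl (w : BWord) (x : CantorC) : wordApp w x ∈ cyl w := ⟨x, rfl⟩

theorem wordApp_ofFn (x : CantorC) (N : ℕ) :
    wordApp (List.ofFn fun i : Fin N => x i) (fun n => x (n + N)) = x := by
  funext n
  by_cases h : n < N
  · simp [wordApp, h]
  · simp [wordApp, h, Nat.sub_add_cancel (not_lt.1 h)]

theorem mem_cyl_ofFn {N : ℕ} (v : Fin N → Bool) (x : CantorC) :
    x ∈ cyl (List.ofFn v) ↔ (fun i : Fin N => x i) = v := by
  constructor
  · rintro ⟨y, rfl⟩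
    funext i
    simp [wordApp]
  · rintro rfl
    exact ⟨_, wordApp_ofFn x N⟩

theorem word_ext {u w : BWord} (h : ∀ x, wordApp u x = wordApp w x) : u = w := by
  induction u generalizing w with
  | nil =>
    cases w with
    | nil => rfl
    | cons c w =>
      have := congrFun (h fun _ => !c) 0
      simp [wordApp_nil, wordApp_cons_zero] at this
  | cons b u ih =>
    cases w with
    | nil =>
      have := congrFun (h fun _ => !b) 0
      simp [wordApp_nil, wordApp_cons_zero] at this
    | cons c w =>
      have h' := fun x => (wordApp_cons_inj _ _ _ _ _ _).1 (h x)
      rw [(h' fun _ => false).1, ih fun x => (h' x).2]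

theorem prefix_of_wordApp_eq {u w : BWord} {x y : CantorC} (h : wordApp u x = wordApp w y)
    (hl : u.length ≤ w.length) : u <+: w := by
  induction u generalizing w with
  | nil => exact List.nil_prefix
  | cons b u ih =>
    cases w with
    | nil => simp at hl
    | cons c w =>
      obtain ⟨rfl, h'⟩ := (wordApp_cons_inj _ _ _ _ _ _).1 h
      exact (List.prefix_cons_inj b).2 (ih h' (by simpa using hl))

/-- The strict lexicographic order on infinite binary sequences. -/
def SeqLt (x y : CantorC) : Prop := ∃ n, (∀ i < n, x i = y i) ∧ x n < y n

theorem seqLt_cons (b c : Bool) (u w : BWord) (x y : CantorC) :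
    SeqLt (wordApp (b :: u) x) (wordApp (c :: w) y) ↔
      b < c ∨ b = c ∧ SeqLt (wordApp u x) (wordApp w y) := by
  constructor
  · rintro ⟨n, h, hn⟩
    cases n with
    | zero => left; simpa only [wordApp_cons_zero] using hn
    | succ n =>
      refine Or.inr ⟨by simpa only [wordApp_cons_zero] using h 0 (Nat.succ_pos n), n, ?_, ?_⟩
      · intro i hi
        simpa only [wordApp_cons_succ] using h (i + 1) (Nat.succ_lt_succ hi)
      · simpa only [wordApp_cons_succ] using hn
  · rintro (h | ⟨rfl, n, h, hn⟩)
    · exact ⟨0, by simp, by simpa only [wordApp_cons_zero] using h⟩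
    · refine ⟨n + 1, ?_, by simpa only [wordApp_cons_succ] using hn⟩
      intro i hi
      cases i with
      | zero => simp only [wordApp_cons_zero]
      | succ i => simpa only [wordApp_cons_succ] using h i (Nat.lt_of_succ_lt_succ hi)

theorem seqLt_wordApp (w : BWord) (x y : CantorC) :
    SeqLt (wordApp w x) (wordApp w y) ↔ SeqLt x y := by
  induction w with
  | nil => simp only [wordApp_nil]
  | cons b w ih => simp [seqLt_cons, ih]

theorem seqLt_wordApp_iff_lex {u w : BWord} (h : Disjoint (cyl u) (cyl w)) (x y : CantorC) :
    SeqLt (wordApp u x) (wordApp w y) ↔ List.Lex (· < ·) u w := by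
  induction u generalizing w with
  | nil =>
    refine (Set.disjoint_left.1 h ⟨wordApp w y, ?_⟩ (wordApp_mem_cyl w y)).elim
    exact wordApp_nil _
  | cons b u ih =>
    cases w with
    | nil =>
      refine (Set.disjoint_left.1 h (wordApp_mem_cyl _ x) ⟨wordApp (b :: u) x, ?_⟩).elim
      exact wordApp_nil _
    | cons c w =>
      rw [seqLt_cons, List.cons_lex_cons_iff]
      by_cases hbc : b = c
      · subst hbc
        have hd : Disjoint (cyl u) (cyl w) := by
          rw [Set.disjoint_left]
          rintro _ ⟨z, rfl⟩ ⟨z', hz'⟩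
          exact Set.disjoint_left.1 h (wordApp_mem_cyl _ z)
            ⟨z', (wordApp_cons_inj _ _ _ _ _ _).2 ⟨rfl, hz'⟩⟩
        simp [ih hd]
      · simp [hbc]

theorem exists_disjoint_cyl {w : BWord} {y : CantorC} (hy : y ∉ cyl w) :
    ∃ u z, y = wordApp u z ∧ Disjoint (cyl w) (cyl u) := by
  refine ⟨_, _, (wordApp_ofFn y w.length).symm, Set.disjoint_left.2 ?_⟩
  rintro _ ⟨z, rfl⟩ ⟨z', h⟩
  have := (prefix_of_wordApp_eq h (by simp)).eq_of_length (by simp)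
  exact hy ⟨_, this ▸ wordApp_ofFn y w.length⟩

/-- `g` maps `β·x` to `α·x` for every sequence `x`. -/
def MapsWord (g : Equiv.Perm CantorC) (α β : BWord) : Prop :=
  ∀ x, g (wordApp β x) = wordApp α x

theorem MapsWord.append {g : Equiv.Perm CantorC} {α β : BWord} (h : MapsWord g α β) (γ : BWord) :
    MapsWord g (α ++ γ) (β ++ γ) := fun x => by
  rw [wordApp_append, wordApp_append, h]

theorem MapsWord.mem_cyl_iff {g : Equiv.Perm CantorC} {α β : BWord} (h : MapsWord g α β)
    (x : CantorC) : x ∈ cyl α ↔ g⁻¹ x ∈ cyl β := by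
  constructor
  · rintro ⟨y, rfl⟩
    exact ⟨y, by rw [← h y, Equiv.Perm.coe_inv, Equiv.symm_apply_apply]⟩
  · rintro ⟨y, hy⟩
    exact ⟨y, by rw [← h y, hy, Equiv.Perm.coe_inv, Equiv.apply_symm_apply]⟩

/-- Near `x` the map `g` replaces a prefix `β` by `α`, with `|α| + |β| ≡ b (mod 2)`. -/
def HasParity (g : Equiv.Perm CantorC) (x : CantorC) (b : ZMod 2) : Prop :=
  ∃ α β, x ∈ cyl β ∧ MapsWord g α β ∧ (α.length + β.length : ZMod 2) = b

theorem HasParity.unique {g : Equiv.Perm CantorC} {x : CantorC} {b c : ZMod 2}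
    (hb : HasParity g x b) (hc : HasParity g x c) : b = c := by
  obtain ⟨α, β, ⟨y, hy⟩, h, rfl⟩ := hb
  obtain ⟨α', β', ⟨y', hy'⟩, h', rfl⟩ := hc
  have key : ∀ {α β α' β' : BWord} {y y' : CantorC}, wordApp β y = wordApp β' y' →
      MapsWord g α β → MapsWord g α' β' → β.length ≤ β'.length →
      (α.length + β.length : ZMod 2) = α'.length + β'.length := by
    intro α β α' β' y y' hyy h h' hl
    obtain ⟨γ, rfl⟩ := prefix_of_wordApp_eq hyy hl
    obtain rfl : α' = α ++ γ := word_ext fun x => by rw [← h' x, h.append γ x]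
    simp only [List.length_append, Nat.cast_add]
    linear_combination -(CharTwo.add_self_eq_zero (γ.length : ZMod 2))
  rcases le_total β.length β'.length with hl | hl
  · exact key (hy.trans hy'.symm) h h' hl
  · exact (key (hy'.trans hy.symm) h' h hl).symm

theorem HasParity.mul {f g : Equiv.Perm CantorC} {x : CantorC} {b c : ZMod 2}
    (hf : HasParity f (g x) c) (hg : HasParity g x b) : HasParity (f * g) x (c + b) := by
  obtain ⟨α, β, ⟨y, rfl⟩, h, rfl⟩ := hg
  obtain ⟨α', β', ⟨y', hy'⟩, h', rfl⟩ := hf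
  rw [h y] at hy'
  rcases le_total α.length β'.length with hl | hl
  · obtain ⟨γ, rfl⟩ := prefix_of_wordApp_eq hy'.symm hl
    refine ⟨α', β ++ γ, ⟨y', ?_⟩, fun z => ?_, ?_⟩
    · rw [wordApp_append] at hy' ⊢
      rw [wordApp_injective _ hy']
    · rw [Equiv.Perm.mul_apply, h.append γ, h']
    · simp only [List.length_append, Nat.cast_add]
      linear_combination -(CharTwo.add_self_eq_zero (α.length : ZMod 2))
  · obtain ⟨γ, rfl⟩ := prefix_of_wordApp_eq hy' hl
    refine ⟨α' ++ γ, β, wordApp_mem_cyl _ _, fun z => ?_, ?_⟩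
    · rw [Equiv.Perm.mul_apply, h, h'.append γ]
    · simp only [List.length_append, Nat.cast_add]
      linear_combination -(CharTwo.add_self_eq_zero (β'.length : ZMod 2))

theorem HasParity.inv {g : Equiv.Perm CantorC} {x : CantorC} {b : ZMod 2}
    (hg : HasParity g x b) : HasParity g⁻¹ (g x) b := by
  obtain ⟨α, β, ⟨y, rfl⟩, h, rfl⟩ := hg
  refine ⟨β, α, ⟨y, (h y).symm⟩, fun z => ?_, add_comm _ _⟩
  rw [← h z, Equiv.Perm.coe_inv, Equiv.symm_apply_apply]

/-- Intrinsic description of Thompson's group `F`: the order automorphisms of the Cantor space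
that locally are prefix replacements. -/
structure IsThompson (g : Equiv.Perm CantorC) : Prop where
  exists_parity : ∀ x, ∃ b, HasParity g x b
  seqLt_iff : ∀ x y, SeqLt (g x) (g y) ↔ SeqLt x y

theorem isThompson_one : IsThompson 1 :=
  ⟨fun x => ⟨_, [], [], ⟨x, wordApp_nil x⟩, fun _ => rfl, rfl⟩, fun _ _ => Iff.rfl⟩

theorem IsThompson.mul {f g : Equiv.Perm CantorC} (hf : IsThompson f) (hg : IsThompson g) :
    IsThompson (f * g) := by
  refine ⟨fun x => ?_, fun x y => (hf.seqLt_iff _ _).trans (hg.seqLt_iff _ _)⟩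
  obtain ⟨b, hb⟩ := hg.exists_parity x
  obtain ⟨c, hc⟩ := hf.exists_parity (g x)
  exact ⟨_, hc.mul hb⟩

theorem IsThompson.inv {g : Equiv.Perm CantorC} (hg : IsThompson g) : IsThompson g⁻¹ := by
  refine ⟨fun x => ?_, fun x y => ?_⟩
  · obtain ⟨b, hb⟩ := hg.exists_parity (g⁻¹ x)
    exact ⟨b, by simpa using hb.inv⟩
  · simpa using (hg.seqLt_iff (g⁻¹ x) (g⁻¹ y)).symm

theorem exists_uniform_length {g : Equiv.Perm CantorC} (hg : ∀ x, ∃ b, HasParity g x b) :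
    ∃ N, ∀ v : Fin N → Bool, ∃ α, MapsWord g α (List.ofFn v) := by
  let U : ℕ → Set CantorC := fun N =>
    (fun x (i : Fin N) => x i) ⁻¹' {v | ∃ α, MapsWord g α (List.ofFn v)}
  have hopen : ∀ N, IsOpen (U N) := fun N => (isOpen_discrete _).preimage (by fun_prop)
  have hmem : ∀ x α β N, x ∈ cyl β → MapsWord g α β → β.length ≤ N → x ∈ U N := by
    rintro x α β N ⟨y, hy⟩ h hN
    obtain ⟨γ, hγ⟩ := prefix_of_wordApp_eq (hy.trans (wordApp_ofFn x N).symm) (by simpa using hN)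
    exact ⟨α ++ γ, hγ ▸ h.append γ⟩
  have hmono : Monotone U := by
    rintro M N hMN x ⟨α, h⟩
    exact hmem x α _ N ((mem_cyl_ofFn _ _).2 rfl) h (by simpa using hMN)
  have hcover : (univ : Set CantorC) ⊆ ⋃ N, U N := by
    intro x _
    obtain ⟨_, α, β, hx, h, _⟩ := hg x
    exact mem_iUnion.2 ⟨_, hmem x α β _ hx h le_rfl⟩
  obtain ⟨N, hN⟩ := isCompact_univ.elim_directed_cover U hopen hcover hmono.directed_le
  refine ⟨N, fun v => ?_⟩
  have hv := hN (mem_univ (wordApp (List.ofFn v) fun _ => false))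
  have he := (mem_cyl_ofFn v _).1 (wordApp_mem_cyl (List.ofFn v) fun _ => false)
  simpa only [U, mem_preimage, he, mem_ofPred_eq] using hv

theorem IsThompson.inF {g : Equiv.Perm CantorC} (hg : IsThompson g) : InF g := by
  classical
  obtain ⟨N, hN⟩ := exists_uniform_length hg.exists_parity
  choose A hA using hN
  have hcode : ∀ x : CantorC, ∃! p : BWord × BWord,
      p ∈ Finset.univ.image (fun v : Fin N → Bool => (A v, List.ofFn v)) ∧ x ∈ cyl p.2 := by
    intro x
    refine ⟨(A fun i => x i, List.ofFn fun i => x i),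
      ⟨Finset.mem_image_of_mem _ (Finset.mem_univ _), (mem_cyl_ofFn _ _).2 rfl⟩, ?_⟩
    rintro p ⟨hp, hx⟩
    obtain ⟨v, -, rfl⟩ := Finset.mem_image.1 hp
    rw [← (mem_cyl_ofFn v x).1 hx]
  refine ⟨Finset.univ.image (fun v : Fin N → Bool => (A v, List.ofFn v)), ⟨fun x => ?_, hcode⟩,
    ?_, ?_⟩
  · refine (existsUnique_congr fun p => and_congr_right fun hp => ?_).2 (hcode (g⁻¹ x))
    obtain ⟨v, -, rfl⟩ := Finset.mem_image.1 hp
    exact (hA v).mem_cyl_iff x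
  · intro p hp q hq
    obtain ⟨v, -, rfl⟩ := Finset.mem_image.1 hp
    obtain ⟨v', -, rfl⟩ := Finset.mem_image.1 hq
    by_cases hv : v = v'
    · subst hv
      simp only [List.lex_irrefl (lt_irrefl : ∀ b : Bool, ¬ b < b)]
    have hd : Disjoint (cyl (List.ofFn v)) (cyl (List.ofFn v')) := Set.disjoint_left.2
      fun x hx hx' => hv (((mem_cyl_ofFn v x).1 hx).symm.trans ((mem_cyl_ofFn v' x).1 hx'))
    have hd' : Disjoint (cyl (A v)) (cyl (A v')) := Set.disjoint_left.2 fun x hx hx' =>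
      Set.disjoint_left.1 hd (((hA v).mem_cyl_iff x).1 hx) (((hA v').mem_cyl_iff x).1 hx')
    let z : CantorC := fun _ => false
    change List.Lex _ (A v) (A v') ↔ List.Lex _ (List.ofFn v) (List.ofFn v')
    rw [← seqLt_wordApp_iff_lex hd z z, ← seqLt_wordApp_iff_lex hd' z z, ← hA v, ← hA v',
      hg.seqLt_iff]
  · intro p hp x
    obtain ⟨v, -, rfl⟩ := Finset.mem_image.1 hp
    exact hA v x

theorem InF.exists_parity {g : Equiv.Perm CantorC} (hg : InF g) (x : CantorC) :
    ∃ b, HasParity g x b := by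
  obtain ⟨J, ⟨-, hJ⟩, -, h⟩ := hg
  obtain ⟨p, ⟨hp, hx⟩, -⟩ := hJ x
  exact ⟨_, p.1, p.2, hx, h p hp, rfl⟩

theorem InH2.hasParity {g : Equiv.Perm CantorC} (hg : InH2 g) (x : CantorC) :
    HasParity g x 0 := by
  obtain ⟨J, ⟨⟨-, hJ⟩, -, h⟩, he⟩ := hg
  obtain ⟨p, ⟨hp, hx⟩, -⟩ := hJ x
  refine ⟨p.1, p.2, hx, h p hp, ?_⟩
  rw [(ZMod.natCast_eq_natCast_iff' _ _ _).2 (he p hp)]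
  exact CharTwo.add_self_eq_zero _

theorem eq_wordApp_cons (x : CantorC) : x = wordApp [x 0] fun n => x (n + 1) := by
  simpa using (wordApp_ofFn x 1).symm

/-- The generator of `F` given by `00 ↦ 0`, `01 ↦ 10`, `1 ↦ 11`. -/
def thompsonGen : Equiv.Perm CantorC where
  toFun x := if x 0 then wordApp [true, true] (fun n => x (n + 1)) else
    if x 1 then wordApp [true, false] (fun n => x (n + 2)) else wordApp [false] (fun n => x (n + 2))
  invFun x := if x 0 then
    if x 1 then wordApp [true] (fun n => x (n + 2)) else wordApp [false, true] (fun n => x (n + 2))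
    else wordApp [false, false] (fun n => x (n + 1))
  left_inv x := by
    funext n
    rcases n with _ | _ | n <;> cases h0 : x 0 <;> cases h1 : x 1 <;>
      simp [wordApp, h0, h1]
  right_inv x := by
    funext n
    rcases n with _ | _ | n <;> cases h0 : x 0 <;> cases h1 : x 1 <;>
      simp [wordApp, h0, h1]

theorem mapsWord_thompsonGen_false_false : MapsWord thompsonGen [false] [false, false] :=
  fun x => by simp [thompsonGen, wordApp]

theorem mapsWord_thompsonGen_false_true : MapsWord thompsonGen [true, false] [false, true] :=
  fun x => by simp [thompsonGen, wordApp]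

theorem mapsWord_thompsonGen_true : MapsWord thompsonGen [true, true] [true] :=
  fun x => by simp [thompsonGen, wordApp]

theorem thompsonGen_cases (x : CantorC) : ∃ y, x = wordApp [false, false] y ∨
    x = wordApp [false, true] y ∨ x = wordApp [true] y := by
  cases h0 : x 0
  · refine ⟨fun n => x (n + 2), ?_⟩
    have h := (wordApp_ofFn x 2).symm
    cases h1 : x 1 <;> simp [h0, h1] at h <;> simp [← h]
  · exact ⟨fun n => x (n + 1), .inr <| .inr <| by simpa only [h0] using eq_wordApp_cons x⟩

theorem isThompson_thompsonGen : IsThompson thompsonGen := by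
  refine ⟨fun x => ?_, fun x y => ?_⟩
  · obtain ⟨y, rfl | rfl | rfl⟩ := thompsonGen_cases x
    · exact ⟨_, _, _, wordApp_mem_cyl _ _, mapsWord_thompsonGen_false_false, rfl⟩
    · exact ⟨_, _, _, wordApp_mem_cyl _ _, mapsWord_thompsonGen_false_true, rfl⟩
    · exact ⟨_, _, _, wordApp_mem_cyl _ _, mapsWord_thompsonGen_true, rfl⟩
  · obtain ⟨x, rfl | rfl | rfl⟩ := thompsonGen_cases x <;>
    obtain ⟨y, rfl | rfl | rfl⟩ := thompsonGen_cases y <;>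
    simp [mapsWord_thompsonGen_false_false _, mapsWord_thompsonGen_false_true _,
      mapsWord_thompsonGen_true _, seqLt_cons]

theorem exists_isThompson_odd (x : CantorC) :
    ∃ a y, IsThompson a ∧ a y = x ∧ HasParity a y 1 := by
  have hx := eq_wordApp_cons x
  cases h0 : x 0 <;> rw [h0] at hx
  · exact ⟨thompsonGen, _, isThompson_thompsonGen,
      (mapsWord_thompsonGen_false_false _).trans hx.symm, _, _, wordApp_mem_cyl _ _,
      mapsWord_thompsonGen_false_false, by decide⟩
  · refine ⟨thompsonGen⁻¹, thompsonGen x, isThompson_thompsonGen.inv, by simp, ?_⟩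
    exact HasParity.inv ⟨_, _, ⟨_, hx.symm⟩, mapsWord_thompsonGen_true, by decide⟩

/-- The permutation acting as `a` on the cylinder of `w` and trivially elsewhere. -/
noncomputable def cylPerm (w : BWord) (a : Equiv.Perm CantorC) : Equiv.Perm CantorC :=
  a.viaEmbedding ⟨wordApp w, wordApp_injective w⟩

theorem cylPerm_wordApp (w : BWord) (a : Equiv.Perm CantorC) (x : CantorC) :
    cylPerm w a (wordApp w x) = wordApp w (a x) :=
  a.viaEmbedding_apply ⟨wordApp w, wordApp_injective w⟩ x

theorem cylPerm_of_notMem {w : BWord} (a : Equiv.Perm CantorC) {x : CantorC} (hx : x ∉ cyl w) :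
    cylPerm w a x = x :=
  a.viaEmbedding_apply_of_notMem ⟨wordApp w, wordApp_injective w⟩ x hx

theorem HasParity.cylPerm {a : Equiv.Perm CantorC} {x : CantorC} {b : ZMod 2}
    (h : HasParity a x b) (w : BWord) : HasParity (cylPerm w a) (wordApp w x) b := by
  obtain ⟨α, β, ⟨y, rfl⟩, h, rfl⟩ := h
  refine ⟨w ++ α, w ++ β, ⟨y, wordApp_append _ _ _⟩, fun z => ?_, ?_⟩
  · rw [wordApp_append, wordApp_append, cylPerm_wordApp, h]
  · simp only [List.length_append, Nat.cast_add]
    linear_combination CharTwo.add_self_eq_zero (w.length : ZMod 2)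

theorem hasParity_cylPerm_of_notMem {w : BWord} (a : Equiv.Perm CantorC) {x : CantorC}
    (hx : x ∉ cyl w) : HasParity (cylPerm w a) x 0 := by
  obtain ⟨u, z, rfl, hu⟩ := exists_disjoint_cyl hx
  exact ⟨u, u, wordApp_mem_cyl _ _,
    fun y => cylPerm_of_notMem a fun hy => Set.disjoint_left.1 hu hy (wordApp_mem_cyl _ _),
    CharTwo.add_self_eq_zero _⟩

theorem IsThompson.cylPerm {a : Equiv.Perm CantorC} (ha : IsThompson a) (w : BWord) :
    IsThompson (cylPerm w a) := by
  refine ⟨fun x => ?_, fun x y => ?_⟩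
  · by_cases hx : x ∈ cyl w
    · obtain ⟨x, rfl⟩ := hx
      obtain ⟨b, hb⟩ := ha.exists_parity x
      exact ⟨b, hb.cylPerm w⟩
    · exact ⟨0, hasParity_cylPerm_of_notMem a hx⟩
  · by_cases hx : x ∈ cyl w <;> by_cases hy : y ∈ cyl w
    · obtain ⟨x, rfl⟩ := hx
      obtain ⟨y, rfl⟩ := hy
      rw [cylPerm_wordApp, cylPerm_wordApp, seqLt_wordApp, seqLt_wordApp, ha.seqLt_iff]
    · rw [cylPerm_of_notMem a hy]
      obtain ⟨x, rfl⟩ := hx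
      obtain ⟨u, z, rfl, hu⟩ := exists_disjoint_cyl hy
      rw [cylPerm_wordApp, seqLt_wordApp_iff_lex hu, seqLt_wordApp_iff_lex hu]
    · rw [cylPerm_of_notMem a hx]
      obtain ⟨y, rfl⟩ := hy
      obtain ⟨u, z, rfl, hu⟩ := exists_disjoint_cyl hx
      rw [cylPerm_wordApp, seqLt_wordApp_iff_lex hu.symm, seqLt_wordApp_iff_lex hu.symm]
    · rw [cylPerm_of_notMem a hx, cylPerm_of_notMem a hy]

theorem exists_mem_cyl_forall_notMem {x : CantorC} {Q : Set CantorC} (hQ : Q.Finite)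
    (hx : x ∉ Q) : ∃ w, x ∈ cyl w ∧ ∀ q ∈ Q, q ∉ cyl w := by
  have hne : ∀ q ∈ Q, ∃ n, q n ≠ x n := fun q hq => Function.ne_iff.1 fun h => hx (h ▸ hq)
  choose! n hn using hne
  obtain ⟨N, hN⟩ := (hQ.image n).bddAbove
  refine ⟨List.ofFn fun i : Fin (N + 1) => x i, (mem_cyl_ofFn _ _).2 rfl, fun q hq hq' => ?_⟩
  have hlt : n q < N + 1 := Nat.lt_succ_of_le (hN (mem_image_of_mem n hq))
  exact hn q hq (congrFun ((mem_cyl_ofFn _ _).1 hq') ⟨n q, hlt⟩)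

/-- An element of `F` that is odd at the preimage of `x` and trivial near the points of `Q`. -/
theorem exists_isThompson_odd_at {x : CantorC} {Q : Set CantorC} (hQ : Q.Finite) (hx : x ∉ Q) :
    ∃ h, IsThompson h ∧ HasParity h (h⁻¹ x) 1 ∧ ∀ q ∈ Q, HasParity h (h⁻¹ q) 0 := by
  obtain ⟨w, ⟨v, rfl⟩, hw⟩ := exists_mem_cyl_forall_notMem hQ hx
  obtain ⟨a, y, ha, rfl, hy⟩ := exists_isThompson_odd v
  refine ⟨cylPerm w a, ha.cylPerm w, ?_, fun q hq => ?_⟩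
  · rw [← cylPerm_wordApp, Equiv.Perm.coe_inv, Equiv.symm_apply_apply]
    exact hy.cylPerm w
  · rw [Equiv.Perm.inv_eq_iff_eq.2 (cylPerm_of_notMem a (hw q hq)).symm]
    exact hasParity_cylPerm_of_notMem a (hw q hq)

theorem exists_ne_notMem {f : Equiv.Perm CantorC} (hf : ∀ x, ∃ b, HasParity f x b) (hf1 : f ≠ 1)
    {Q : Set CantorC} (hQ : Q.Finite) : ∃ y, f y ≠ y ∧ y ∉ Q ∧ f y ∉ Q := by
  obtain ⟨x, hx⟩ : ∃ x, f x ≠ x := by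
    by_contra! h
    exact hf1 (Equiv.ext h)
  obtain ⟨_, α, β, ⟨z, rfl⟩, h, _⟩ := hf x
  rw [h] at hx
  obtain ⟨n, hn⟩ := Function.ne_iff.1 hx
  let φ : ℕ → CantorC := fun m => wordApp β (Function.update z (n + 1 + m) (!z (n + 1 + m)))
  have hφ : Function.Injective φ := by
    intro m m' hm
    by_contra hne
    have := congrFun (wordApp_injective β hm) (n + 1 + m)
    simp [hne] at this
  have hstable : ∀ (w : BWord) m,
      wordApp w (Function.update z (n + 1 + m) (!z (n + 1 + m))) n = wordApp w z n := by
    intro w m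
    unfold wordApp
    split_ifs with hw
    · rfl
    · rw [Function.update_of_ne (by omega)]
  obtain ⟨_, ⟨m, rfl⟩, hm⟩ := (Set.infinite_range_of_injective hφ).exists_notMem_finite
    (hQ.union (hQ.preimage f.injective.injOn))
  refine ⟨φ m, fun he => hn ?_, fun hq => hm (Or.inl hq), fun hq => hm (Or.inr hq)⟩
  have := congrFun ((h _).symm.trans he) n
  simpa only [φ, hstable] using this

/-- Conjugating `f` by `g` gives an element that is odd at `g⁻¹ y`, as certified by the parities
of `f` and `g`. -/
def OddConj (g f : Equiv.Perm CantorC) (y : CantorC) : Prop :=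
  ∃ a b c, HasParity g (g⁻¹ y) a ∧ HasParity f y b ∧ HasParity g (g⁻¹ (f y)) c ∧ a + b + c = 1

theorem OddConj.not_inH2 {g f : Equiv.Perm CantorC} {y : CantorC} (h : OddConj g f y) :
    ¬ InH2 (g⁻¹ * f * g) := by
  obtain ⟨a, b, c, ha, hb, hc, habc⟩ := h
  intro hH
  have hc' : HasParity g⁻¹ (f y) c := by simpa using hc.inv
  have hcb := hc'.mul hb
  rw [← g.apply_symm_apply y] at hcb
  have h0 := (hcb.mul ha).unique (hH.hasParity (g⁻¹ y))
  have : (1 : ZMod 2) = 0 := by rw [← habc, ← h0]; ring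
  exact one_ne_zero this

theorem HasParity.mul_inv_apply {g h : Equiv.Perm CantorC} {y : CantorC} {a b : ZMod 2}
    (hg : HasParity g (g⁻¹ y) a) (hh : HasParity h (h⁻¹ (g⁻¹ y)) b) :
    HasParity (g * h) ((g * h)⁻¹ y) (a + b) := by
  rw [mul_inv_rev, Equiv.Perm.mul_apply]
  refine HasParity.mul ?_ hh
  rwa [Equiv.Perm.coe_inv, Equiv.apply_symm_apply]

theorem exists_isThompson_oddConj (s : Finset (Equiv.Perm CantorC))
    (hs : ∀ f ∈ s, (∀ x, ∃ b, HasParity f x b) ∧ f ≠ 1) :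
    ∃ g, IsThompson g ∧ ∃ Q : Set CantorC, Q.Finite ∧
      ∀ f ∈ s, ∃ y ∈ Q, f y ∈ Q ∧ OddConj g f y := by
  classical
  induction s using Finset.induction_on with
  | empty => exact ⟨1, isThompson_one, ∅, Set.finite_empty, by simp⟩
  | insert f s _ ih =>
    obtain ⟨g, hg, Q, hQ, hodd⟩ := ih fun f' hf' => hs f' (Finset.mem_insert_of_mem hf')
    obtain ⟨hf, hf1⟩ := hs f (Finset.mem_insert_self f s)
    obtain ⟨y, hy, hyQ, hfyQ⟩ := exists_ne_notMem hf hf1 hQ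
    obtain ⟨a, ha⟩ := hg.exists_parity (g⁻¹ y)
    obtain ⟨b, hb⟩ := hf y
    obtain ⟨c, hc⟩ := hg.exists_parity (g⁻¹ (f y))
    suffices h : ∃ g', IsThompson g' ∧ OddConj g' f y ∧
        ∀ f' ∈ s, ∃ y ∈ Q, f' y ∈ Q ∧ OddConj g' f' y by
      obtain ⟨g', hg', hfy, hs'⟩ := h
      refine ⟨g', hg', insert y (insert (f y) Q), (hQ.insert _).insert _, fun f' hf' => ?_⟩
      obtain rfl | hf' := Finset.mem_insert.1 hf'
      · exact ⟨y, by simp, by simp, hfy⟩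
      · obtain ⟨z, hz, hfz, ho⟩ := hs' f' hf'
        exact ⟨z, by simp [hz], by simp [hfz], ho⟩
    by_cases habc : a + b + c = 1
    · exact ⟨g, hg, ⟨a, b, c, ha, hb, hc, habc⟩, hodd⟩
    have habc' : a + b + c = 0 := by
      generalize a + b + c = t at habc
      revert t
      decide
    have hnot : g⁻¹ y ∉ (g⁻¹ : Equiv.Perm CantorC) '' insert (f y) Q := by
      rw [(g⁻¹ : Equiv.Perm CantorC).injective.mem_set_image, Set.mem_insert_iff]
      exact not_or.2 ⟨hy.symm, hyQ⟩
    obtain ⟨h, hh, hh1, hh0⟩ := exists_isThompson_odd_at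
      ((hQ.insert (f y)).image (g⁻¹ : Equiv.Perm CantorC)) hnot
    replace hh0 : ∀ z ∈ insert (f y) Q, HasParity h (h⁻¹ (g⁻¹ z)) 0 :=
      fun z hz => hh0 _ (Set.mem_image_of_mem _ hz)
    refine ⟨g * h, hg.mul hh, ⟨a + 1, b, c + 0, ha.mul_inv_apply hh1, hb,
      hc.mul_inv_apply (hh0 _ (Set.mem_insert _ _)), ?_⟩, fun f' hf' => ?_⟩
    · linear_combination habc'
    · obtain ⟨z, hz, hfz, a', b', c', ha', hb', hc', h1⟩ := hodd f' hf'
      refine ⟨z, hz, hfz, a' + 0, b', c' + 0, ha'.mul_inv_apply (hh0 _ (Or.inr hz)), hb',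
        hc'.mul_inv_apply (hh0 _ (Or.inr hfz)), ?_⟩
      simpa using h1

/-- finitely many nontrivial elements of `F` can be simultaneously
conjugated out of `H₂`; hence the intersection of all conjugates of `H₂` is trivial,
i.e. the action of `F` on `F/H₂` is faithful. -/
theorem stmt7 :
    (∀ (k : ℕ) (f : Fin k → Equiv.Perm CantorC),
      (∀ j, InF (f j)) → (∀ j, f j ≠ 1) →
      ∃ g : Equiv.Perm CantorC, InF g ∧ ∀ j, ¬ InH2 (g⁻¹ * f j * g)) ∧
    (∀ f : Equiv.Perm CantorC, InF f →
      (∀ g : Equiv.Perm CantorC, InF g → InH2 (g⁻¹ * f * g)) → f = 1) := by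
  classical
  have key : ∀ (k : ℕ) (f : Fin k → Equiv.Perm CantorC),
      (∀ j, InF (f j)) → (∀ j, f j ≠ 1) →
      ∃ g : Equiv.Perm CantorC, InF g ∧ ∀ j, ¬ InH2 (g⁻¹ * f j * g) := by
    intro k f hf hf1
    obtain ⟨g, hg, _, _, h⟩ := exists_isThompson_oddConj (Finset.univ.image f) (by
      simpa using fun j => ⟨(hf j).exists_parity, hf1 j⟩)
    refine ⟨g, hg.inF, fun j => ?_⟩
    obtain ⟨_, _, _, ho⟩ := h (f j) (Finset.mem_image_of_mem f (Finset.mem_univ j))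
    exact ho.not_inH2
  refine ⟨key, fun f hf h => ?_⟩
  by_contra hf1
  obtain ⟨g, hg, hn⟩ := key 1 (fun _ => f) (fun _ => hf) fun _ => hf1
  exact hn 0 (h g hg)
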